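/- arXiv:2007.01460 — 8 statements merged into one kernel-verified Lean document; each statement's English description precedes it below -/
import Mathlib

section
/- Let H ∈ (1/2, 1) and let 0 ≤ s ≤ t be real numbers. Then min(2 − 2^{2H−1}, 1)·(t − s)^{2H} ≤ (t + s)^{2H} + (t − s)^{2H} − 2^{2H−1}(t^{2H} + s^{2H}) ≤ max(2 − 2^{2H−1}, 1)·(t − s)^{2H}. -/
/-- The odd part of `x ↦ (1 + x) ^ q` is convex on `[0, 1]` when `0 ≤ q ≤ 1`. -/
theorem convexOn_one_add_rpow_sub_one_sub_rpow {q : ℝ} (hq0 : 0 ≤ q) (hq1 : q ≤ 1) :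
    ConvexOn ℝ (Set.Icc 0 1) fun x : ℝ => (1 + x) ^ q - (1 - x) ^ q := by
  have hder (r x : ℝ) (hx : x ∈ Set.Ioo (0 : ℝ) 1) :
      HasDerivAt (fun y : ℝ => (1 + y) ^ r) (r * (1 + x) ^ (r - 1)) x ∧
        HasDerivAt (fun y : ℝ => (1 - y) ^ r) (-(r * (1 - x) ^ (r - 1))) x := by
    constructor
    · have h := ((hasDerivAt_id x).const_add 1).rpow_const (p := r)
        (Or.inl (by simp only [id]; linarith [hx.1]))
      simpa using h
    · have h := ((hasDerivAt_id x).const_sub 1).rpow_const (p := r)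
        (Or.inl (by simp only [id]; linarith [hx.2]))
      simpa using h
  refine convexOn_of_hasDerivWithinAt2_nonneg (convex_Icc 0 1)
    (f' := fun x => q * ((1 + x) ^ (q - 1) + (1 - x) ^ (q - 1)))
    (f'' := fun x => q * ((1 - q) * ((1 - x) ^ (q - 1 - 1) - (1 + x) ^ (q - 1 - 1)))) ?_ ?_ ?_ ?_
  · exact (((continuous_const.add continuous_id).rpow_const fun _ => Or.inr hq0).sub
      ((continuous_const.sub continuous_id).rpow_const fun _ => Or.inr hq0)).continuousOn
  · rw [interior_Icc]
    intro x hx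
    obtain ⟨h₁, h₂⟩ := hder q x hx
    exact ((h₁.sub h₂).congr_deriv (by ring)).hasDerivWithinAt
  · rw [interior_Icc]
    intro x hx
    obtain ⟨h₁, h₂⟩ := hder (q - 1) x hx
    exact (((h₁.add h₂).const_mul q).congr_deriv (by ring)).hasDerivWithinAt
  · rw [interior_Icc]
    intro x hx
    have h : (1 + x) ^ (q - 1 - 1) ≤ (1 - x) ^ (q - 1 - 1) :=
      Real.rpow_le_rpow_of_nonpos (by linarith [hx.2]) (by linarith [hx.1]) (by linarith)
    exact mul_nonneg hq0 (mul_nonneg (by linarith) (by linarith))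

/-- A function vanishing at `0` and `1` whose derivative is concave and vanishes at `0` is
nonnegative on `[0, 1]`. -/
theorem nonneg_of_concaveOn_deriv {h h' : ℝ → ℝ} (hd : ∀ x, HasDerivAt h (h' x) x)
    (hc : ConcaveOn ℝ (Set.Icc 0 1) h') (h'0 : h' 0 = 0) (h0 : h 0 = 0) (h1 : h 1 = 0)
    {x : ℝ} (hx : x ∈ Set.Icc (0 : ℝ) 1) : 0 ≤ h x := by
  by_contra! hneg
  have hx0 : 0 < x := hx.1.lt_of_ne (by rintro rfl; linarith)
  have hx1 : x < 1 := hx.2.lt_of_ne (by rintro rfl; linarith)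
  have hcont : Continuous h := continuous_iff_continuousAt.2 fun y => (hd y).continuousAt
  obtain ⟨a, ha, hae⟩ := exists_hasDerivAt_eq_slope h h' hx0 hcont.continuousOn fun y _ => hd y
  obtain ⟨b, hb, hbe⟩ := exists_hasDerivAt_eq_slope h h' hx1 hcont.continuousOn fun y _ => hd y
  have ha' : h' a < 0 := by rw [hae, h0]; exact div_neg_of_neg_of_pos (by linarith) (by linarith)
  have hb' : 0 < h' b := by rw [hbe, h1]; exact div_pos (by linarith) (by linarith)
  have hb0 : 0 < b := hx0.trans hb.1
  have hab : a / b ≤ 1 := (div_le_one hb0).2 (ha.2.trans hb.1).le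
  have hab0 : 0 ≤ a / b := div_nonneg ha.1.le hb0.le
  have key := hc.2 (Set.left_mem_Icc.2 zero_le_one) (⟨hb0.le, hb.2.le⟩ : b ∈ Set.Icc (0 : ℝ) 1)
    (sub_nonneg.2 hab) hab0 (sub_add_cancel 1 (a / b))
  simp only [smul_eq_mul, h'0, mul_zero, zero_add, div_mul_cancel₀ a hb0.ne'] at key
  have := mul_nonneg hab0 hb'.le
  linarith

/-- The even part of `x ↦ (1 + x) ^ p` lies below the parabola interpolating it at `0` and `1`. -/
theorem one_add_rpow_add_one_sub_rpow_le {p x : ℝ} (hp1 : 1 < p) (hp2 : p ≤ 2)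
    (hx : x ∈ Set.Icc (0 : ℝ) 1) :
    (1 + x) ^ p + (1 - x) ^ p ≤ 2 + ((2 : ℝ) ^ p - 2) * x ^ 2 := by
  have hd (x : ℝ) : HasDerivAt
      (fun y : ℝ => 2 + ((2 : ℝ) ^ p - 2) * y ^ 2 - ((1 + y) ^ p + (1 - y) ^ p))
      (2 * ((2 : ℝ) ^ p - 2) * x - p * ((1 + x) ^ (p - 1) - (1 - x) ^ (p - 1))) x := by
    have h₁ := ((hasDerivAt_id x).const_add 1).rpow_const (p := p) (Or.inr hp1.le)
    have h₂ := ((hasDerivAt_id x).const_sub 1).rpow_const (p := p) (Or.inr hp1.le)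
    have h₃ := ((hasDerivAt_pow 2 x).const_mul ((2 : ℝ) ^ p - 2)).const_add 2
    refine (h₃.sub (h₁.add h₂)).congr_deriv ?_
    simp only [id]
    push_cast
    ring
  have hc : ConcaveOn ℝ (Set.Icc 0 1) fun x : ℝ =>
      2 * ((2 : ℝ) ^ p - 2) * x - p * ((1 + x) ^ (p - 1) - (1 - x) ^ (p - 1)) := by
    have hlin : ConcaveOn ℝ (Set.Icc (0 : ℝ) 1) fun x : ℝ => 2 * ((2 : ℝ) ^ p - 2) * x :=
      (LinearMap.mulLeft ℝ (2 * ((2 : ℝ) ^ p - 2))).concaveOn (convex_Icc 0 1)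
    exact hlin.sub ((convexOn_one_add_rpow_sub_one_sub_rpow (q := p - 1) (by linarith)
      (by linarith)).smul (by linarith : (0 : ℝ) ≤ p))
  have hp0 : p ≠ 0 := by linarith
  have := nonneg_of_concaveOn_deriv hd hc (by simp) (by norm_num)
    (by norm_num [Real.zero_rpow hp0]) hx
  linarith

/-- A reverse power-mean inequality for `1 < p ≤ 2`. -/
theorem two_rpow_mul_rpow_add_rpow_le {p s t : ℝ} (hp1 : 1 < p) (hp2 : p ≤ 2)
    (hs : 0 ≤ s) (hst : s ≤ t) :
    (2 : ℝ) ^ (p - 1) * (t ^ p + s ^ p) ≤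
      (t + s) ^ p + ((2 : ℝ) ^ (p - 1) - 1) * (t - s) ^ p := by
  have hp0 : p ≠ 0 := by linarith
  rcases (hs.trans hst).eq_or_lt with rfl | ht
  · obtain rfl : s = 0 := le_antisymm hst hs
    simp [Real.zero_rpow hp0]
  have ha : 0 < t + s := by linarith
  set x := (t - s) / (t + s) with hxdef
  have hx : x ∈ Set.Icc (0 : ℝ) 1 :=
    ⟨div_nonneg (by linarith) ha.le, (div_le_one ha).2 (by linarith)⟩
  have hxa : t - s = (t + s) * x := by rw [hxdef]; field_simp
  have h2t : (2 : ℝ) ^ p * t ^ p = (t + s) ^ p * (1 + x) ^ p := by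
    rw [← Real.mul_rpow (by norm_num) ht.le, ← Real.mul_rpow ha.le (by linarith [hx.1])]
    congr 1; linarith
  have h2s : (2 : ℝ) ^ p * s ^ p = (t + s) ^ p * (1 - x) ^ p := by
    rw [← Real.mul_rpow (by norm_num) hs, ← Real.mul_rpow ha.le (by linarith [hx.2])]
    congr 1; linarith
  have hts : (t - s) ^ p = (t + s) ^ p * x ^ p := by
    rw [hxa, Real.mul_rpow ha.le hx.1]
  have h2 : (2 : ℝ) ^ p = 2 * (2 : ℝ) ^ (p - 1) := by
    rw [Real.rpow_sub_one two_ne_zero]; ring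
  have hc : 1 ≤ (2 : ℝ) ^ (p - 1) := Real.one_le_rpow (by norm_num) (by linarith)
  have hxp : x ^ 2 ≤ x ^ p := by
    rw [← Real.rpow_two]
    exact Real.rpow_le_rpow_of_exponent_ge_of_imp hx.1 hx.2 hp2 fun _ h => absurd h two_ne_zero
  have hmain : (1 + x) ^ p + (1 - x) ^ p ≤ 2 + ((2 : ℝ) ^ p - 2) * x ^ p :=
    (one_add_rpow_add_one_sub_rpow_le hp1 hp2 hx).trans
      (by gcongr; linarith)
  have hscaled := mul_le_mul_of_nonneg_left hmain (Real.rpow_nonneg ha.le p)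
  rw [hts]
  rw [h2] at h2t h2s hscaled
  linarith


/-- Increment-variance bounds for sub-fractional Brownian motion:
for `H ∈ (1/2, 1)` and `0 ≤ s ≤ t`,
`min (2 - 2^(2H-1)) 1 * (t-s)^(2H) ≤ (t+s)^(2H) + (t-s)^(2H) - 2^(2H-1)*(t^(2H)+s^(2H))
  ≤ max (2 - 2^(2H-1)) 1 * (t-s)^(2H)`. -/
theorem subfbm_increment_variance_bounds
    (H s t : ℝ) (hH : H ∈ Set.Ioo (1/2 : ℝ) 1) (hs : 0 ≤ s) (hst : s ≤ t) :
    min (2 - (2 : ℝ) ^ (2*H - 1)) 1 * (t - s) ^ (2*H)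
      ≤ (t + s) ^ (2*H) + (t - s) ^ (2*H) - (2 : ℝ) ^ (2*H - 1) * (t ^ (2*H) + s ^ (2*H))
    ∧ (t + s) ^ (2*H) + (t - s) ^ (2*H) - (2 : ℝ) ^ (2*H - 1) * (t ^ (2*H) + s ^ (2*H))
      ≤ max (2 - (2 : ℝ) ^ (2*H - 1)) 1 * (t - s) ^ (2*H) := by
  obtain ⟨hH0, hH1⟩ := hH
  have hc : 1 ≤ (2 : ℝ) ^ (2*H - 1) := Real.one_le_rpow (by norm_num) (by linarith)
  have hlower := two_rpow_mul_rpow_add_rpow_le (p := 2*H) (by linarith) (by linarith) hs hst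
  have hupper : (t + s) ^ (2*H) ≤ (2 : ℝ) ^ (2*H - 1) * (t ^ (2*H) + s ^ (2*H)) :=
    NNReal.rpow_add_le_mul_rpow_add_rpow ⟨t, hs.trans hst⟩ ⟨s, hs⟩ (by linarith)
  rw [min_eq_left (by linarith), max_eq_right (by linarith)]
  constructor <;> linarith
end

section
/- Let H ∈ (1/2, 1). For all real s, t ≥ 0, one has s^{2H} + t^{2H} − (1/2)(|s − t|^{2H} + (s + t)^{2H}) = H(2H − 1) ∫₀ᵗ ∫₀ˢ (|u − v|^{2H−2} − (u + v)^{2H−2}) du dv, where the double integral is a Lebesgue integral over [0,s] × [0,t] (the integrand is integrable there since 2H − 2 > −1). -/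
open intervalIntegral

theorem intervalIntegrable_abs_rpow {r : ℝ} (hr : -1 < r) (a b : ℝ) :
    IntervalIntegrable (fun x : ℝ => |x| ^ r) MeasureTheory.volume a b := by
  have pos : ∀ c : ℝ, 0 ≤ c →
      IntervalIntegrable (fun x : ℝ => |x| ^ r) MeasureTheory.volume 0 c := by
    intro c hc
    refine IntervalIntegrable.congr (fun x hx => ?_) (intervalIntegrable_rpow' hr)
    rw [Set.uIoc_of_le hc] at hx
    simp only [abs_of_pos hx.1]
  have zero : ∀ c : ℝ, IntervalIntegrable (fun x : ℝ => |x| ^ r) MeasureTheory.volume 0 c := by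
    intro c
    rcases le_total 0 c with hc | hc
    · exact pos c hc
    · rw [IntervalIntegrable.iff_comp_neg]
      simpa using pos (-c) (by linarith)
  exact (zero a).symm.trans (zero b)

theorem integral_abs_rpow {r : ℝ} (hr : -1 < r) (a b : ℝ) :
    ∫ x in a..b, |x| ^ r = (b * |b| ^ r - a * |a| ^ r) / (r + 1) := by
  have hr' : r + 1 ≠ 0 := by linarith
  have pos : ∀ c : ℝ, 0 ≤ c → ∫ x in (0 : ℝ)..c, |x| ^ r = c * |c| ^ r / (r + 1) := by
    intro c hc
    have h : ∫ x in (0 : ℝ)..c, |x| ^ r = ∫ x in (0 : ℝ)..c, x ^ r := by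
      refine integral_congr fun x hx => ?_
      rw [Set.uIcc_of_le hc] at hx
      simp only [abs_of_nonneg hx.1]
    rw [h, integral_rpow (Or.inl hr), Real.zero_rpow hr', abs_of_nonneg hc,
      Real.rpow_add_one' hc hr']
    ring
  have zero : ∀ c : ℝ, ∫ x in (0 : ℝ)..c, |x| ^ r = c * |c| ^ r / (r + 1) := by
    intro c
    rcases le_total 0 c with hc | hc
    · exact pos c hc
    · have h := integral_comp_neg (a := 0) (b := c) fun x : ℝ => |x| ^ r
      simp only [abs_neg, neg_zero] at h
      rw [h, integral_symm, pos (-c) (by linarith), abs_neg]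
      ring
  rw [← integral_add_adjacent_intervals (intervalIntegrable_abs_rpow hr a 0)
    (intervalIntegrable_abs_rpow hr 0 b), integral_symm, zero, zero]
  ring

theorem intervalIntegrable_mul_abs_rpow {r : ℝ} (hr : -1 < r) (a b : ℝ) :
    IntervalIntegrable (fun x : ℝ => x * |x| ^ r) MeasureTheory.volume a b :=
  (intervalIntegrable_abs_rpow hr a b).continuousOn_mul continuousOn_id

theorem integral_mul_abs_rpow {r : ℝ} (hr : -1 < r) (a b : ℝ) :
    ∫ x in a..b, x * |x| ^ r = (|b| ^ (r + 2) - |a| ^ (r + 2)) / (r + 2) := by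
  have hr' : r + 2 ≠ 0 := by linarith
  have hd : ∀ x ∈ Set.uIcc a b,
      HasDerivAt (fun y : ℝ => |y| ^ (r + 2) / (r + 2)) (x * |x| ^ r) x := by
    intro x _
    have h := (hasDerivAt_abs_rpow x (p := r + 2) (by linarith)).div_const (r + 2)
    rwa [add_sub_cancel_right, mul_assoc, mul_div_cancel_left₀ _ hr', mul_comm] at h
  rw [integral_eq_sub_of_hasDerivAt hd (intervalIntegrable_mul_abs_rpow hr a b)]
  ring

theorem integral_abs_sub_rpow_sub_add_rpow {r s v : ℝ} (hr : -1 < r) (hs : 0 ≤ s) (hv : 0 ≤ v) :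
    ∫ u in (0 : ℝ)..s, (|u - v| ^ r - (u + v) ^ r) =
      ((s - v) * |s - v| ^ r + 2 * (v * |v| ^ r) - (s + v) * |s + v| ^ r) / (r + 1) := by
  have h : ∫ u in (0 : ℝ)..s, (|u - v| ^ r - (u + v) ^ r) =
      ∫ u in (0 : ℝ)..s, (|u - v| ^ r - |u + v| ^ r) := by
    refine integral_congr fun u hu => ?_
    rw [Set.uIcc_of_le hs] at hu
    simp only [abs_of_nonneg (add_nonneg hu.1 hv)]
  have hsub : IntervalIntegrable (fun u : ℝ => |u - v| ^ r) MeasureTheory.volume 0 s := by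
    simpa using (intervalIntegrable_abs_rpow hr (0 - v) (s - v)).comp_sub_right v
  have hadd : IntervalIntegrable (fun u : ℝ => |u + v| ^ r) MeasureTheory.volume 0 s := by
    simpa using (intervalIntegrable_abs_rpow hr (0 + v) (s + v)).comp_add_right v
  rw [h, integral_sub hsub hadd, integral_comp_sub_right (fun x : ℝ => |x| ^ r),
    integral_comp_add_right (fun x : ℝ => |x| ^ r), integral_abs_rpow hr, integral_abs_rpow hr,
    zero_sub, zero_add, abs_neg]
  ring

/-- The covariance of sub-fractional Brownian motion with Hurst parameter `H ∈ (1/2, 1)` as a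
double integral of the kernel `φ_H(u,v) = H(2H-1)(|u-v|^(2H-2) - (u+v)^(2H-2))`:
for `s, t ≥ 0`,
`s^(2H) + t^(2H) - (1/2)(|s-t|^(2H) + (s+t)^(2H))
  = H(2H-1) ∫₀ᵗ ∫₀ˢ (|u-v|^(2H-2) - (u+v)^(2H-2)) du dv`. -/
theorem subfbm_covariance_eq_double_integral
    (H s t : ℝ) (hH : H ∈ Set.Ioo (1/2 : ℝ) 1) (hs : 0 ≤ s) (ht : 0 ≤ t) :
    s ^ (2*H) + t ^ (2*H) - (1/2) * (|s - t| ^ (2*H) + (s + t) ^ (2*H))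
      = H * (2*H - 1) *
        ∫ v in (0:ℝ)..t, ∫ u in (0:ℝ)..s,
          (|u - v| ^ (2*H - 2) - (u + v) ^ (2*H - 2)) := by
  have hH0 : H ≠ 0 := by linarith [hH.1]
  have hH1 : 2 * H - 1 ≠ 0 := by linarith [hH.1]
  have hr : -1 < 2 * H - 2 := by linarith [hH.1]
  have inner : ∫ v in (0:ℝ)..t, ∫ u in (0:ℝ)..s,
      (|u - v| ^ (2*H - 2) - (u + v) ^ (2*H - 2)) =
      ∫ v in (0:ℝ)..t, ((s - v) * |s - v| ^ (2*H - 2) + 2 * (v * |v| ^ (2*H - 2))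
        - (s + v) * |s + v| ^ (2*H - 2)) / (2*H - 2 + 1) := by
    refine integral_congr fun v hv => ?_
    rw [Set.uIcc_of_le ht] at hv
    exact integral_abs_sub_rpow_sub_add_rpow hr hs hv.1
  have hsub : IntervalIntegrable (fun v : ℝ => (s - v) * |s - v| ^ (2*H - 2))
      MeasureTheory.volume 0 t := by
    simpa using (intervalIntegrable_mul_abs_rpow hr (s - 0) (s - t)).comp_sub_left s
  have hadd : IntervalIntegrable (fun v : ℝ => (s + v) * |s + v| ^ (2*H - 2))
      MeasureTheory.volume 0 t := by
    simpa using (intervalIntegrable_mul_abs_rpow hr (s + 0) (s + t)).comp_add_left s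
  have hmid := (intervalIntegrable_mul_abs_rpow hr 0 t).const_mul 2
  rw [inner, integral_div, integral_sub (hsub.add hmid) hadd, integral_add hsub hmid,
    integral_const_mul, integral_comp_sub_left (fun x : ℝ => x * |x| ^ (2*H - 2)),
    integral_comp_add_left (fun x : ℝ => x * |x| ^ (2*H - 2)), integral_mul_abs_rpow hr,
    integral_mul_abs_rpow hr, integral_mul_abs_rpow hr, sub_zero, add_zero, abs_zero,
    abs_of_nonneg hs, abs_of_nonneg ht, abs_of_nonneg (add_nonneg hs ht), sub_add_cancel,
    Real.zero_rpow (by simpa using hH0), show 2 * H - 2 + 1 = 2 * H - 1 by ring]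
  field_simp
  ring
end

section
/- Let H ∈ (1/2, 1) and let θ be a nonzero real number. There exists a constant C > 0, depending only on θ and H, such that for all real numbers 0 < u₂ ≤ u₁ ≤ v₁ and 0 < u₂ ≤ v₂ ≤ v₁ with u₁ − u₂ = v₁ − v₂, one has |∫_{u₂}^{u₁} ∫_{v₂}^{v₁} e^{−θ(s+t)} |s − t|^{2H−2} ds dt| ≤ C |e^{−θ(u₁+v₁)} − e^{−θ(u₂+v₂)}| · (v₁ − u₂)^{2H−1}. -/
open Real intervalIntegral

open MeasureTheory in
/-- The mass of the kernel `|r| ^ a` on the symmetric interval `(-M, M]`. -/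
lemma lintegral_abs_rpow_Ioc_neg_self {a M : ℝ} (ha : -1 < a) (hM : 0 ≤ M) :
    ∫⁻ r in Set.Ioc (-M) M, ENNReal.ofReal (|r| ^ a) =
      ENNReal.ofReal (2 * (M ^ (a + 1) / (a + 1))) := by
  have h_right : IntervalIntegrable (fun r : ℝ => |r| ^ a) volume 0 M := by
    refine (intervalIntegrable_rpow' ha).congr fun r hr => ?_
    rw [Set.uIoc_of_le hM] at hr
    simp only [abs_of_pos hr.1]
  have h_left : IntervalIntegrable (fun r : ℝ => |r| ^ a) volume (-M) 0 := by
    have h := (IntervalIntegrable.iff_comp_neg (by simp)).1 h_right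
    simpa using h.symm
  have h_value : ∫ r in (0 : ℝ)..M, |r| ^ a = M ^ (a + 1) / (a + 1) := by
    have h_eq : ∫ r in (0 : ℝ)..M, |r| ^ a = ∫ r in (0 : ℝ)..M, r ^ a := by
      refine integral_congr fun r hr => ?_
      rw [Set.uIcc_of_le hM] at hr
      simp only [abs_of_nonneg hr.1]
    rw [h_eq, integral_rpow (Or.inl ha), Real.zero_rpow (by linarith), sub_zero]
  have h_value_left : ∫ r in (-M)..0, |r| ^ a = M ^ (a + 1) / (a + 1) := by
    have h := integral_comp_neg (a := 0) (b := M) (fun r : ℝ => |r| ^ a)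
    simp only [abs_neg, neg_zero] at h
    rw [← h, h_value]
  have h_int := h_left.trans h_right
  rw [← ofReal_integral_eq_lintegral_ofReal, ← integral_of_le (by linarith),
    ← integral_add_adjacent_intervals h_left h_right, h_value, h_value_left, two_mul]
  · exact (intervalIntegrable_iff_integrableOn_Ioc_of_le (by linarith)).1 h_int
  · exact Filter.Eventually.of_forall fun r => by positivity

open MeasureTheory in
/-- The integral of `exp (-θ (2t + r))` over those `t` with `p < 2t + r ≤ q`. -/
lemma lintegral_exp_two_mul_add {θ p q : ℝ} (hθ : θ ≠ 0) (hpq : p ≤ q) (r : ℝ) :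
    ∫⁻ t in Set.Ioc ((p - r) / 2) ((q - r) / 2), ENNReal.ofReal (exp (-θ * (2 * t + r))) =
      ENNReal.ofReal ((exp (-θ * p) - exp (-θ * q)) / (2 * θ)) := by
  have h_cont : Continuous fun t : ℝ => exp (-θ * (2 * t + r)) := by fun_prop
  have h_deriv (t : ℝ) : HasDerivAt (fun t => exp (-θ * (2 * t + r)) / (-(2 * θ)))
      (exp (-θ * (2 * t + r))) t := by
    have h := (((((hasDerivAt_id t).const_mul 2).add_const r).const_mul (-θ)).exp).div_const
      (-(2 * θ))
    refine h.congr_deriv ?_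
    simp only [id]
    field_simp
  rw [← ofReal_integral_eq_lintegral_ofReal, ← integral_of_le (by linarith),
    integral_eq_sub_of_hasDerivAt (fun t _ => h_deriv t) (h_cont.intervalIntegrable _ _)]
  · congr 1
    rw [show 2 * ((q - r) / 2) + r = q by ring, show 2 * ((p - r) / 2) + r = p by ring]
    field_simp
    ring
  · exact h_cont.integrableOn_Ioc
  · exact Filter.Eventually.of_forall fun t => (exp_pos _).le

open MeasureTheory in
/-- In the coordinates `r = s - t` and `p = s + t`, the rectangle `(u₂, u₁] × (v₂, v₁]` lies in
`|r| ≤ M`, `u₂ + v₂ < p ≤ u₁ + v₁`. -/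
lemma lintegral_exp_mul_abs_sub_rpow_le {θ a u₁ u₂ v₁ v₂ M : ℝ} (hθ : θ ≠ 0) (ha : -1 < a)
    (hM : 0 ≤ M) (hu : u₂ ≤ u₁) (hv : v₂ ≤ v₁) (h_upper : v₁ - u₂ ≤ M) (h_lower : u₁ - v₂ ≤ M) :
    ∫⁻ t in Set.Ioc u₂ u₁, ∫⁻ s in Set.Ioc v₂ v₁,
        ENNReal.ofReal (exp (-θ * (s + t)) * |s - t| ^ a) ≤
      ENNReal.ofReal (2 * (M ^ (a + 1) / (a + 1)) *
        ((exp (-θ * (u₂ + v₂)) - exp (-θ * (u₁ + v₁))) / (2 * θ))) := by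
  set K : ℝ → ENNReal := (Set.Ioc (-M) M).indicator fun r => ENNReal.ofReal (|r| ^ a) with hK
  set S : Set (ℝ × ℝ) := (fun x => 2 * x.1 + x.2) ⁻¹' Set.Ioc (u₂ + v₂) (u₁ + v₁) with hS
  set E : ℝ × ℝ → ENNReal := S.indicator fun x => ENNReal.ofReal (exp (-θ * (2 * x.1 + x.2)))
    with hE
  have hS_meas : MeasurableSet S :=
    measurableSet_Ioc.preimage (by fun_prop)
  have hK_meas : Measurable K := Measurable.indicator (by fun_prop) measurableSet_Ioc
  have hE_meas : Measurable E := Measurable.indicator (by fun_prop) hS_meas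
  have h_inner (r : ℝ) : ∫⁻ t, E (t, r) =
      ENNReal.ofReal ((exp (-θ * (u₂ + v₂)) - exp (-θ * (u₁ + v₁))) / (2 * θ)) := by
    rw [← lintegral_exp_two_mul_add hθ (add_le_add hu hv) r,
      ← lintegral_indicator measurableSet_Ioc]
    refine lintegral_congr fun t => ?_
    have h_iff : (t, r) ∈ S ↔
        t ∈ Set.Ioc ((u₂ + v₂ - r) / 2) ((u₁ + v₁ - r) / 2) := by
      simp only [hS, Set.mem_preimage, Set.mem_Ioc]
      constructor <;> rintro ⟨h₁, h₂⟩ <;> constructor <;> linarith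
    by_cases h : (t, r) ∈ S
    · rw [hE, Set.indicator_of_mem h, Set.indicator_of_mem (h_iff.1 h)]
    · rw [hE, Set.indicator_of_notMem h, Set.indicator_of_notMem (mt h_iff.2 h)]
  calc
    _ ≤ ∫⁻ t, ∫⁻ r, K r * E (t, r) := by
      rw [← lintegral_indicator measurableSet_Ioc]
      refine lintegral_mono fun t => Set.indicator_apply_le' (fun ht => ?_) fun _ => zero_le
      rw [← lintegral_indicator measurableSet_Ioc, ← lintegral_add_right_eq_self _ t]
      refine lintegral_mono fun r => Set.indicator_apply_le' (fun hr => ?_) fun _ => zero_le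
      have hr_mem : r ∈ Set.Ioc (-M) M := ⟨by linarith [hr.1, ht.2], by linarith [hr.2, ht.1]⟩
      have hS_mem : (t, r) ∈ S := ⟨by linarith [hr.1, ht.1], by linarith [hr.2, ht.2]⟩
      simp only [hK, hE, Set.indicator_of_mem hr_mem, Set.indicator_of_mem hS_mem]
      rw [mul_comm (exp _), ENNReal.ofReal_mul (by positivity), add_sub_cancel_right,
        show r + t + t = 2 * t + r by ring]
    _ = ∫⁻ r, ∫⁻ t, K r * E (t, r) :=
      lintegral_lintegral_swap ((hK_meas.comp measurable_snd).mul hE_meas).aemeasurable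
    _ = ∫⁻ r, K r *
        ENNReal.ofReal ((exp (-θ * (u₂ + v₂)) - exp (-θ * (u₁ + v₁))) / (2 * θ)) := by
      refine lintegral_congr fun r => ?_
      have h_section : Measurable fun t => E (t, r) := hE_meas.comp (by fun_prop)
      rw [lintegral_const_mul _ h_section, h_inner]
    _ = _ := by
      have h_pos : 0 < a + 1 := by linarith
      rw [lintegral_mul_const _ hK_meas, hK, lintegral_indicator measurableSet_Ioc,
        lintegral_abs_rpow_Ioc_neg_self ha hM, ← ENNReal.ofReal_mul (by positivity)]

open MeasureTheory in
/-- Lemma 3.2 of the paper: for `H ∈ (1/2, 1)` and `θ ≠ 0`, there is a constant `C > 0`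
(depending only on `θ` and `H`) such that for all `0 < u₂ ≤ u₁ ≤ v₁`, `0 < u₂ ≤ v₂ ≤ v₁`
with `u₁ - u₂ = v₁ - v₂`,
`|∫_{u₂}^{u₁} ∫_{v₂}^{v₁} e^{-θ(s+t)} |s-t|^{2H-2} ds dt|
  ≤ C |e^{-θ(u₁+v₁)} - e^{-θ(u₂+v₂)}| (v₁ - u₂)^{2H-1}`. -/
theorem exp_kernel_double_integral_bound
    (H θ : ℝ) (hH : H ∈ Set.Ioo (1/2 : ℝ) 1) (hθ : θ ≠ 0) :
    ∃ C > 0, ∀ u₂ u₁ v₁ v₂ : ℝ,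
      0 < u₂ → u₂ ≤ u₁ → u₁ ≤ v₁ → u₂ ≤ v₂ → v₂ ≤ v₁ → u₁ - u₂ = v₁ - v₂ →
      |∫ t in u₂..u₁, ∫ s in v₂..v₁, Real.exp (-θ * (s + t)) * |s - t| ^ (2*H - 2)|
        ≤ C * |Real.exp (-θ * (u₁ + v₁)) - Real.exp (-θ * (u₂ + v₂))| * (v₁ - u₂) ^ (2*H - 1) := by
  have h_pos : 0 < 2 * H - 1 := by linarith [hH.1]
  refine ⟨1 / (|θ| * (2 * H - 1)), by positivity, fun u₂ u₁ v₁ v₂ _ hu huv₁ huv₂ hv _ => ?_⟩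
  have hM : 0 ≤ v₁ - u₂ := by linarith
  have h_bound := lintegral_exp_mul_abs_sub_rpow_le (a := 2 * H - 2) hθ (by linarith) hM hu hv
    le_rfl (by linarith)
  rw [show 2 * H - 2 + 1 = 2 * H - 1 by ring] at h_bound
  have h_norm : ‖∫ t in u₂..u₁, ∫ s in v₂..v₁,
      exp (-θ * (s + t)) * |s - t| ^ (2 * H - 2)‖ₑ ≤
      ∫⁻ t in Set.Ioc u₂ u₁, ∫⁻ s in Set.Ioc v₂ v₁,
        ENNReal.ofReal (exp (-θ * (s + t)) * |s - t| ^ (2 * H - 2)) := by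
    simp only [integral_of_le hu, integral_of_le hv]
    refine (enorm_integral_le_lintegral_enorm _).trans (lintegral_mono fun t => ?_)
    refine (enorm_integral_le_lintegral_enorm _).trans (lintegral_mono fun s => ?_)
    exact (Real.enorm_of_nonneg (by positivity)).le
  have h_le : 2 * ((v₁ - u₂) ^ (2 * H - 1) / (2 * H - 1)) *
      ((exp (-θ * (u₂ + v₂)) - exp (-θ * (u₁ + v₁))) / (2 * θ)) ≤
      1 / (|θ| * (2 * H - 1)) * |exp (-θ * (u₁ + v₁)) - exp (-θ * (u₂ + v₂))| *
        (v₁ - u₂) ^ (2 * H - 1) := by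
    refine (mul_le_mul_of_nonneg_left (le_abs_self _) (by positivity)).trans_eq ?_
    rw [abs_div, abs_mul, abs_two, abs_sub_comm]
    field_simp
  rw [← Real.norm_eq_abs, ← ENNReal.ofReal_le_ofReal_iff (by positivity), ofReal_norm]
  exact (h_norm.trans h_bound).trans (ENNReal.ofReal_le_ofReal h_le)
end

section
/- Let H ∈ (1/2, 1) and θ < 0. There exists a constant C > 0, depending only on H and θ, such that for every t ∈ [0, 1], one has H(2H−1) ∫₀ᵗ ∫₀ᵗ e^{θ(2t − u − v)} (|u − v|^{2H−2} − (u + v)^{2H−2}) du dv ≤ C (e^{−2θ t} − 1) t^{2H−1}. -/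
open Real intervalIntegral

/-- For `a > -1`, the function `v ↦ |u - v| ^ a` is integrable on `[0, t]` for `u ∈ [0, t]`, with the
explicit value of its integral. -/
lemma intervalIntegrable_and_integral_abs_sub_rpow {a u t : ℝ} (ha : -1 < a) (hu : 0 ≤ u)
    (hut : u ≤ t) :
    IntervalIntegrable (fun v => |u - v| ^ a) MeasureTheory.volume 0 t ∧
      ∫ v in (0:ℝ)..t, |u - v| ^ a = (u ^ (a + 1) + (t - u) ^ (a + 1)) / (a + 1) := by
  have ha' : a + 1 ≠ 0 := by linarith
  have left_eq : Set.EqOn (fun v => (u - v) ^ a) (fun v => |u - v| ^ a) (Set.uIcc 0 u) := by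
    intro v hv
    rw [Set.uIcc_of_le hu] at hv
    simp only [abs_of_nonneg (sub_nonneg.2 hv.2)]
  have right_eq : Set.EqOn (fun v => (v - u) ^ a) (fun v => |u - v| ^ a) (Set.uIcc u t) := by
    intro v hv
    rw [Set.uIcc_of_le hut] at hv
    simp only [abs_sub_comm u v, abs_of_nonneg (sub_nonneg.2 hv.1)]
  have left_int : IntervalIntegrable (fun v => |u - v| ^ a) MeasureTheory.volume 0 u := by
    have h := (intervalIntegrable_rpow' (a := u) (b := 0) ha).comp_sub_left u
    rw [sub_self, sub_zero] at h
    exact h.congr (left_eq.mono Set.uIoc_subset_uIcc)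
  have right_int : IntervalIntegrable (fun v => |u - v| ^ a) MeasureTheory.volume u t := by
    have h := (intervalIntegrable_rpow' (a := 0) (b := t - u) ha).comp_sub_right u
    rw [zero_add, sub_add_cancel] at h
    exact h.congr (right_eq.mono Set.uIoc_subset_uIcc)
  refine ⟨left_int.trans right_int, ?_⟩
  rw [← integral_add_adjacent_intervals left_int right_int, ← integral_congr left_eq,
    ← integral_congr right_eq, integral_comp_sub_left (fun x => x ^ a),
    integral_comp_sub_right (fun x => x ^ a), integral_rpow (Or.inl ha), integral_rpow (Or.inl ha)]
  simp only [sub_self, sub_zero, zero_rpow ha']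
  ring

lemma abs_exp_mul_subfbm_kernel_le {a θ t u v : ℝ} (ha : a ≤ 0) (hθ : θ ≤ 0)
    (hu : u ∈ Set.Ioc 0 t) (hv : v ∈ Set.Ioc 0 t) :
    |Real.exp (θ * (2 * t - u - v)) * (|u - v| ^ a - (u + v) ^ a)| ≤ |u - v| ^ a + v ^ a := by
  have hexp : Real.exp (θ * (2 * t - u - v)) ≤ 1 :=
    Real.exp_le_one_iff.2 (mul_nonpos_of_nonpos_of_nonneg hθ (by linarith [hu.2, hv.2]))
  have hdiag : 0 ≤ |u - v| ^ a := by positivity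
  have hsum : 0 ≤ (u + v) ^ a := rpow_nonneg (by linarith [hu.1, hv.1]) a
  have hle : (u + v) ^ a ≤ v ^ a := rpow_le_rpow_of_nonpos hv.1 (by linarith [hu.1]) ha
  rw [abs_mul, Real.abs_exp]
  calc _ ≤ |(|u - v| ^ a - (u + v) ^ a)| := mul_le_of_le_one_left (abs_nonneg _) hexp
    _ ≤ _ := abs_le.2 ⟨by linarith, by linarith⟩

lemma abs_integral_exp_mul_subfbm_kernel_le {a θ t u : ℝ} (ha : -1 < a) (ha0 : a ≤ 0) (hθ : θ ≤ 0)
    (hu : u ∈ Set.Ioc 0 t) :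
    |∫ v in (0:ℝ)..t, Real.exp (θ * (2 * t - u - v)) * (|u - v| ^ a - (u + v) ^ a)| ≤
      3 * t ^ (a + 1) / (a + 1) := by
  have ha' : 0 < a + 1 := by linarith
  have ht : 0 ≤ t := hu.1.le.trans hu.2
  obtain ⟨hint, hval⟩ := intervalIntegrable_and_integral_abs_sub_rpow ha hu.1.le hu.2
  have hint' : IntervalIntegrable (fun v : ℝ => v ^ a) MeasureTheory.volume 0 t :=
    intervalIntegrable_rpow' ha
  have hu_le : u ^ (a + 1) ≤ t ^ (a + 1) := rpow_le_rpow hu.1.le hu.2 ha'.le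
  have htu_le : (t - u) ^ (a + 1) ≤ t ^ (a + 1) :=
    rpow_le_rpow (sub_nonneg.2 hu.2) (by linarith [hu.1]) ha'.le
  rw [← Real.norm_eq_abs]
  calc _ ≤ ∫ v in (0:ℝ)..t, (|u - v| ^ a + v ^ a) :=
        norm_integral_le_of_norm_le ht (Filter.Eventually.of_forall fun v hv =>
          abs_exp_mul_subfbm_kernel_le ha0 hθ hu hv) (hint.add hint')
    _ = (u ^ (a + 1) + (t - u) ^ (a + 1) + t ^ (a + 1)) / (a + 1) := by
        rw [integral_add hint hint', hval, integral_rpow (Or.inl ha), zero_rpow ha'.ne']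
        ring
    _ ≤ 3 * t ^ (a + 1) / (a + 1) := by
        gcongr
        linarith

/-- Second bound of Lemma 3.3 of the paper: for `H ∈ (1/2, 1)` and `θ < 0` there is a constant
`C > 0` (depending only on `H` and `θ`) such that for every `t ∈ [0, 1]`, the variance
`H(2H-1) ∫₀ᵗ ∫₀ᵗ e^{θ(2t - u - v)} (|u-v|^{2H-2} - (u+v)^{2H-2}) du dv`
is at most `C (e^{-2θt} - 1) t^{2H-1}`. -/
theorem subfbm_wiener_integral_variance_bound
    (H θ : ℝ) (hH : H ∈ Set.Ioo (1/2 : ℝ) 1) (hθ : θ < 0) :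
    ∃ C > 0, ∀ t ∈ Set.Icc (0:ℝ) 1,
      H * (2*H - 1) *
        ∫ u in (0:ℝ)..t, ∫ v in (0:ℝ)..t,
          Real.exp (θ * (2*t - u - v)) * (|u - v| ^ (2*H - 2) - (u + v) ^ (2*H - 2))
      ≤ C * (Real.exp (-2*θ*t) - 1) * t ^ (2*H - 1) := by
  obtain ⟨hH1, hH2⟩ := hH
  refine ⟨3 * H / (-2 * θ), div_pos (by linarith) (by linarith), fun t ht => ?_⟩
  have hH' : 0 < 2 * H - 1 := by linarith
  have hbound := norm_integral_le_of_norm_le_const (a := 0) (b := t)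
    (f := fun u => ∫ v in (0:ℝ)..t,
      Real.exp (θ * (2 * t - u - v)) * (|u - v| ^ (2 * H - 2) - (u + v) ^ (2 * H - 2)))
    (C := 3 * t ^ (2 * H - 1) / (2 * H - 1)) fun u hu => by
      rw [Set.uIoc_of_le ht.1] at hu
      have h := abs_integral_exp_mul_subfbm_kernel_le (a := 2 * H - 2) (by linarith) (by linarith)
        hθ.le hu
      rwa [show 2 * H - 2 + 1 = 2 * H - 1 by ring] at h
  rw [sub_zero, abs_of_nonneg ht.1] at hbound
  have hexp : -2 * θ * t ≤ Real.exp (-2 * θ * t) - 1 := by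
    linarith [Real.add_one_le_exp (-2 * θ * t)]
  have hcoef : 0 ≤ 3 * H / (-2 * θ) := div_nonneg (by linarith) (by linarith)
  have htpow : 0 ≤ t ^ (2 * H - 1) := rpow_nonneg ht.1 _
  calc _ ≤ H * (2 * H - 1) * (3 * t ^ (2 * H - 1) / (2 * H - 1) * t) :=
        mul_le_mul_of_nonneg_left ((le_abs_self _).trans hbound)
          (mul_nonneg (by linarith) hH'.le)
    _ = 3 * H / (-2 * θ) * (-2 * θ * t) * t ^ (2 * H - 1) := by
        have hθ' := hθ.ne
        have hd := hH'.ne'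
        generalize 2 * H - 1 = d at hd
        field_simp
    _ ≤ _ := by gcongr
end

section
/- Fix x₀, μ ∈ ℝ, θ ≠ 0, σ > 0, and a continuous function f : [0,1] → ℝ with f(0) = 0. Suppose X : [0,1] → ℝ is continuous and satisfies X_t = x₀ + ∫₀ᵗ (μ + θ X_s) ds + σ f(t) for all t ∈ [0,1], and let X⁰_t = x₀ e^{θt} + (μ/θ)(e^{θt} − 1). Then sup_{t ∈ [0,1]} |X_t − X⁰_t| ≤ √2 · σ · e^{θ²} · sup_{t ∈ [0,1]} |f(t)|. -/
open Real intervalIntegral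

/-- Gronwall estimate for the deviation of a solution of the linear integral equation
`X_t = x₀ + ∫₀ᵗ (μ + θ X_s) ds + g t` from the solution with `g = 0`. -/
theorem abs_sub_linear_solution_le {x₀ μ θ C : ℝ} (hθ : θ ≠ 0) {g X : ℝ → ℝ}
    (hX : ContinuousOn X (Set.Icc 0 1)) (hg : ∀ t ∈ Set.Icc (0:ℝ) 1, |g t| ≤ C)
    (hsol : ∀ t ∈ Set.Icc (0:ℝ) 1, X t = x₀ + (∫ s in (0:ℝ)..t, (μ + θ * X s)) + g t)
    {t : ℝ} (ht : t ∈ Set.Icc (0:ℝ) 1) :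
    |X t - (x₀ * Real.exp (θ * t) + (μ/θ) * (Real.exp (θ * t) - 1))|
      ≤ C * Real.exp (|θ| * t) := by
  let Y : ℝ → ℝ := Set.IccExtend zero_le_one (Set.domRestrict (Set.Icc (0:ℝ) 1) X)
  have hY : Continuous Y := (continuousOn_iff_continuous_domRestrict.1 hX).Icc_extend'
  have hYX : ∀ s ∈ Set.Icc (0:ℝ) 1, Y s = X s := fun s hs =>
    Set.IccExtend_of_mem zero_le_one _ hs
  let Z : ℝ → ℝ := fun t => x₀ * Real.exp (θ * t) + (μ/θ) * (Real.exp (θ * t) - 1)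
  let J : ℝ → ℝ := fun t => x₀ + (∫ s in (0:ℝ)..t, (μ + θ * Y s)) - Z t
  have hJ : ∀ t ∈ Set.Icc (0:ℝ) 1, X t - Z t = J t + g t := by
    intro t ht
    have h : (∫ s in (0:ℝ)..t, (μ + θ * Y s)) = ∫ s in (0:ℝ)..t, (μ + θ * X s) := by
      refine intervalIntegral.integral_congr fun s hs => ?_
      rw [Set.uIcc_of_le ht.1] at hs
      simp only [hYX s ⟨hs.1, hs.2.trans ht.2⟩]
    simp only [J, h]
    rw [hsol t ht]
    ring
  have hJ' : ∀ t, HasDerivAt J (θ * (Y t - Z t)) t := by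
    intro t
    have hc : Continuous fun s => μ + θ * Y s := by fun_prop
    have h1 := intervalIntegral.integral_hasDerivAt_right (hc.intervalIntegrable 0 t)
      (hc.stronglyMeasurableAtFilter _ _) hc.continuousAt
    have h2 : HasDerivAt (fun t => Real.exp (θ * t)) (Real.exp (θ * t) * (θ * 1)) t :=
      ((hasDerivAt_id t).const_mul θ).exp
    have h3 := (h1.const_add x₀).sub ((h2.const_mul x₀).add ((h2.sub_const 1).const_mul (μ/θ)))
    refine h3.congr_deriv ?_
    simp only [Z]
    field_simp
    ring
  have hJ0 : J 0 = 0 := by simp [J, Z]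
  have key := norm_le_gronwallBound_of_norm_deriv_right_le (f := J) (δ := 0) (K := |θ|)
    (ε := |θ| * C) (a := 0) (b := 1)
    (fun t _ => (hJ' t).continuousAt.continuousWithinAt)
    (fun t _ => (hJ' t).hasDerivWithinAt) (by simp [hJ0])
    (fun t ht => by
      have ht' := Set.Ico_subset_Icc_self ht
      rw [hYX t ht', hJ t ht', Real.norm_eq_abs, Real.norm_eq_abs, abs_mul, ← mul_add]
      have := abs_add_le (J t) (g t)
      have := hg t ht'
      gcongr
      linarith) t ht
  have hθ' : |θ| ≠ 0 := abs_ne_zero.2 hθ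
  rw [gronwallBound_of_K_ne_0 hθ', mul_div_cancel_left₀ _ hθ', Real.norm_eq_abs, sub_zero] at key
  change |X t - Z t| ≤ _
  rw [hJ t ht]
  have := abs_add_le (J t) (g t)
  have := hg t ht
  linarith

theorem exp_abs_le_sqrt_two_mul_exp_sq (θ : ℝ) :
    Real.exp |θ| ≤ Real.sqrt 2 * Real.exp (θ^2) := by
  have h1 : Real.exp (1/4) ≤ Real.sqrt 2 := by
    refine Real.le_sqrt_of_sq_le (abs_le_of_sq_le_sq' ?_ zero_le_two).2
    rw [← pow_mul, ← Real.exp_nat_mul]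
    norm_num
    linarith [Real.exp_one_lt_d9]
  calc Real.exp |θ| ≤ Real.exp (1/4 + θ^2) :=
        Real.exp_le_exp.2 (by nlinarith [sq_nonneg (|θ| - 1/2), sq_abs θ])
    _ = Real.exp (1/4) * Real.exp (θ^2) := Real.exp_add _ _
    _ ≤ Real.sqrt 2 * Real.exp (θ^2) := by gcongr

/-- Pathwise estimate from Proposition 3.1 of the paper: if `X` is a continuous pathwise
solution of the Vasicek equation `X_t = x₀ + ∫₀ᵗ (μ + θ X_s) ds + σ f(t)` on `[0,1]` driven
by a continuous path `f` with `f 0 = 0`, and `X⁰_t = x₀ e^{θt} + (μ/θ)(e^{θt} - 1)` is the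
noise-free solution, then
`sup_{t ∈ [0,1]} |X_t - X⁰_t| ≤ √2 σ e^{θ²} sup_{t ∈ [0,1]} |f t|`. -/
theorem vasicek_pathwise_deviation_bound
    (x₀ μ θ σ : ℝ) (hθ : θ ≠ 0) (hσ : 0 < σ)
    (f : ℝ → ℝ) (hf : ContinuousOn f (Set.Icc 0 1)) (hf0 : f 0 = 0)
    (X : ℝ → ℝ) (hX : ContinuousOn X (Set.Icc 0 1))
    (hsol : ∀ t ∈ Set.Icc (0:ℝ) 1,
      X t = x₀ + (∫ s in (0:ℝ)..t, (μ + θ * X s)) + σ * f t) :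
    (⨆ t : Set.Icc (0:ℝ) 1,
        |X t - (x₀ * Real.exp (θ * t) + (μ/θ) * (Real.exp (θ * t) - 1))|)
      ≤ Real.sqrt 2 * σ * Real.exp (θ^2) * ⨆ t : Set.Icc (0:ℝ) 1, |f t| := by
  have hbdd : BddAbove (Set.range fun t : Set.Icc (0:ℝ) 1 => |f t|) :=
    isCompact_range (continuousOn_iff_continuous_domRestrict.1 hf).abs |>.bddAbove
  set M := ⨆ t : Set.Icc (0:ℝ) 1, |f t|
  have hM0 : 0 ≤ M := Real.iSup_nonneg fun _ => abs_nonneg _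
  have hg : ∀ t ∈ Set.Icc (0:ℝ) 1, |σ * f t| ≤ σ * M := by
    intro t ht
    rw [abs_mul, abs_of_pos hσ]
    exact mul_le_mul_of_nonneg_left (le_ciSup hbdd ⟨t, ht⟩) hσ.le
  refine Real.iSup_le (fun t => ?_) (by positivity)
  calc _ ≤ σ * M * Real.exp (|θ| * t) := abs_sub_linear_solution_le hθ hX hg hsol t.2
    _ ≤ σ * M * Real.exp |θ| := by
        gcongr
        exact mul_le_of_le_one_right (abs_nonneg θ) t.2.2
    _ ≤ σ * M * (Real.sqrt 2 * Real.exp (θ^2)) := by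
        gcongr
        exact exp_abs_le_sqrt_two_mul_exp_sq θ
    _ = Real.sqrt 2 * σ * Real.exp (θ^2) * M := by ring
end

section
/- Fix x₀, μ ∈ ℝ, θ ≠ 0, σ > 0, and a continuous function f : [0,1] → ℝ with f(0) = 0. Suppose X : [0,1] → ℝ is continuous and satisfies X_t = x₀ + ∫₀ᵗ (μ + θ X_s) ds + σ f(t) for all t ∈ [0,1]. Then for every t ∈ [0,1], |X_t| ≤ √2 · (|x₀| + σ · sup_{s ∈ [0,1]} |f(s)| + |μ|) · e^{θ² t²}. -/
/-- Grönwall's inequality in integral form, with constant coefficients. -/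
theorem le_mul_exp_of_le_add_mul_integral {u : ℝ → ℝ} {C k T : ℝ} (hT : 0 ≤ T) (hk : 0 < k)
    (hu : ContinuousOn u (Set.Icc 0 T)) (hu0 : ∀ t ∈ Set.Icc 0 T, 0 ≤ u t)
    (h : ∀ t ∈ Set.Icc 0 T, u t ≤ C + k * ∫ s in (0:ℝ)..t, u s) :
    ∀ t ∈ Set.Icc 0 T, u t ≤ C * Real.exp (k * t) := by
  set v : ℝ → ℝ := Set.IccExtend hT ((Set.Icc 0 T).domRestrict u)
  have hv : Continuous v := (continuousOn_iff_continuous_domRestrict.1 hu).Icc_extend'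
  have hvu : ∀ s ∈ Set.Icc 0 T, v s = u s := fun s hs ↦ Set.IccExtend_of_mem _ _ hs
  have hint : ∀ t ∈ Set.Icc 0 T, ∫ s in (0:ℝ)..t, u s = ∫ s in (0:ℝ)..t, v s := by
    intro t ht
    refine intervalIntegral.integral_congr fun s hs ↦ (hvu s ?_).symm
    rw [Set.uIcc_of_le ht.1] at hs
    exact ⟨hs.1, hs.2.trans ht.2⟩
  have hderiv : ∀ t, HasDerivAt (fun t ↦ ∫ s in (0:ℝ)..t, v s) (v t) t := fun t ↦
    intervalIntegral.integral_hasDerivAt_right (hv.intervalIntegrable _ _)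
      (hv.stronglyMeasurableAtFilter _ _) hv.continuousAt
  have hnonneg : ∀ t ∈ Set.Icc 0 T, 0 ≤ ∫ s in (0:ℝ)..t, v s := fun t ht ↦
    intervalIntegral.integral_nonneg ht.1 fun s hs ↦ by
      have hs' : s ∈ Set.Icc 0 T := ⟨hs.1, hs.2.trans ht.2⟩
      exact hvu s hs' ▸ hu0 s hs'
  have hgron := norm_le_gronwallBound_of_norm_deriv_right_le (δ := 0) (K := k) (ε := C)
    (a := 0) (b := T) (f := fun t ↦ ∫ s in (0:ℝ)..t, v s) (f' := v)
    (fun t _ ↦ (hderiv t).continuousAt.continuousWithinAt)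
    (fun t _ ↦ (hderiv t).hasDerivWithinAt) (by simp)
    (fun t ht ↦ by
      have ht' := Set.Ico_subset_Icc_self ht
      rw [Real.norm_of_nonneg (hnonneg t ht'), hvu t ht', Real.norm_of_nonneg (hu0 t ht'),
        ← hint t ht']
      linarith [h t ht'])
  intro t ht
  have hbound := (Real.le_norm_self _).trans (hgron t ht)
  simp only [gronwallBound_of_K_ne_0 hk.ne', ← hint t ht,
    sub_zero, zero_mul, zero_add] at hbound
  calc u t ≤ C + k * ∫ s in (0:ℝ)..t, u s := h t ht
    _ ≤ C + k * (C / k * (Real.exp (k * t) - 1)) := by gcongr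
    _ = C * Real.exp (k * t) := by field_simp; ring

theorem exp_le_sqrt_two_mul_exp_sq (a : ℝ) :
    Real.exp a ≤ Real.sqrt 2 * Real.exp (a ^ 2) := by
  have hquarter : Real.exp (1 / 4) ≤ Real.sqrt 2 := by
    apply Real.le_sqrt_of_sq_le
    rw [← Real.exp_nat_mul]
    refine (sq_le_sq₀ (Real.exp_nonneg _) zero_le_two).1 ?_
    rw [← Real.exp_nat_mul]
    norm_num
    linarith [Real.exp_one_lt_three]
  calc Real.exp a ≤ Real.exp (1 / 4 + a ^ 2) :=
        Real.exp_le_exp.2 (by linarith [sq_nonneg (a - 1 / 2)])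
    _ = Real.exp (1 / 4) * Real.exp (a ^ 2) := Real.exp_add _ _
    _ ≤ Real.sqrt 2 * Real.exp (a ^ 2) := by gcongr

/-- Pathwise a priori bound from Proposition 3.1 of the paper: if `X` is a continuous pathwise
solution of the Vasicek equation `X_t = x₀ + ∫₀ᵗ (μ + θ X_s) ds + σ f(t)` on `[0,1]` driven
by a continuous path `f` with `f 0 = 0`, then for every `t ∈ [0,1]`,
`|X_t| ≤ √2 (|x₀| + σ sup_{s ∈ [0,1]} |f s| + |μ|) e^{θ² t²}`. -/
theorem vasicek_pathwise_apriori_bound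
    (x₀ μ θ σ : ℝ) (hθ : θ ≠ 0) (hσ : 0 < σ)
    (f : ℝ → ℝ) (hf : ContinuousOn f (Set.Icc 0 1)) (hf0 : f 0 = 0)
    (X : ℝ → ℝ) (hX : ContinuousOn X (Set.Icc 0 1))
    (hsol : ∀ t ∈ Set.Icc (0:ℝ) 1,
      X t = x₀ + (∫ s in (0:ℝ)..t, (μ + θ * X s)) + σ * f t) :
    ∀ t ∈ Set.Icc (0:ℝ) 1,
      |X t| ≤ Real.sqrt 2 * (|x₀| + σ * (⨆ s : Set.Icc (0:ℝ) 1, |f s|) + |μ|)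
        * Real.exp (θ^2 * t^2) := by
  set M := ⨆ s : Set.Icc (0:ℝ) 1, |f s|
  have hfM : ∀ s ∈ Set.Icc (0:ℝ) 1, |f s| ≤ M := fun s hs ↦
    le_ciSup (f := fun s : Set.Icc (0:ℝ) 1 ↦ |f s|)
      (isCompact_range (continuousOn_iff_continuous_domRestrict.1 hf.abs)).bddAbove ⟨s, hs⟩
  have hM : 0 ≤ M := (abs_nonneg _).trans (hfM 0 ⟨le_rfl, zero_le_one⟩)
  have hgron : ∀ t ∈ Set.Icc (0:ℝ) 1,
      |X t| ≤ (|x₀| + σ * M + |μ|) * Real.exp (|θ| * t) := by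
    refine le_mul_exp_of_le_add_mul_integral zero_le_one (abs_pos.2 hθ) hX.abs
      (fun t _ ↦ abs_nonneg _) fun t ht ↦ ?_
    have hXt : ContinuousOn X (Set.uIcc 0 t) := by
      rw [Set.uIcc_of_le ht.1]
      exact hX.mono (Set.Icc_subset_Icc_right ht.2)
    have hsplit : ∫ s in (0:ℝ)..t, (μ + θ * X s) = t * μ + θ * ∫ s in (0:ℝ)..t, X s := by
      rw [intervalIntegral.integral_add intervalIntegrable_const (hXt.intervalIntegrable.const_mul θ),
        intervalIntegral.integral_const, intervalIntegral.integral_const_mul, sub_zero, smul_eq_mul]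
    rw [hsol t ht, hsplit]
    calc |x₀ + (t * μ + θ * ∫ s in (0:ℝ)..t, X s) + σ * f t|
        ≤ |x₀| + (|t * μ| + |θ * ∫ s in (0:ℝ)..t, X s|) + |σ * f t| :=
          (abs_add_le _ _).trans (add_le_add_left ((abs_add_le _ _).trans
            (add_le_add_right (abs_add_le _ _) _)) _)
      _ = |x₀| + (t * |μ| + |θ| * |∫ s in (0:ℝ)..t, X s|) + σ * |f t| := by
          rw [abs_mul, abs_mul, abs_mul, abs_of_nonneg ht.1, abs_of_pos hσ]
      _ ≤ |x₀| + (1 * |μ| + |θ| * ∫ s in (0:ℝ)..t, |X s|) + σ * M := by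
          gcongr
          · exact ht.2
          · exact intervalIntegral.abs_integral_le_integral_abs ht.1
          · exact hfM t ht
      _ = |x₀| + σ * M + |μ| + |θ| * ∫ s in (0:ℝ)..t, |X s| := by ring
  intro t ht
  have hexp := exp_le_sqrt_two_mul_exp_sq (|θ| * t)
  rw [mul_pow, sq_abs] at hexp
  calc |X t| ≤ (|x₀| + σ * M + |μ|) * Real.exp (|θ| * t) := hgron t ht
    _ ≤ (|x₀| + σ * M + |μ|) * (Real.sqrt 2 * Real.exp (θ ^ 2 * t ^ 2)) := by gcongr
    _ = _ := by ring
end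

section
/- Let n ≥ 2 be an integer, θ₀, μ₀, σ ∈ ℝ, and let f : [0,1] → ℝ satisfy f(0) = 0. Let X₀, X₁, ..., Xₙ be real numbers satisfying the Euler recursion X_i = X_{i−1} + (μ₀ + θ₀ X_{i−1})/n + σ (f(i/n) − f((i−1)/n)) for i = 1, ..., n, and suppose D := (1/n) Σ_{i=1}^{n} X_{i−1}² − (1/n²)(Σ_{i=1}^{n} X_{i−1})² ≠ 0. Then the least squares estimator μ̂ = [Σ_{i=1}^{n} (X_i − X_{i−1}) · Σ_{i=1}^{n} X_{i−1}² − Σ_{i=1}^{n} X_{i−1} · Σ_{i=1}^{n} (X_i − X_{i−1}) X_{i−1}] / (n·D) satisfies μ̂ = μ₀ + σ · [Σ_{i=1}^{n} X_{i−1}² · f(1) − Σ_{i=1}^{n} X_{i−1} · Σ_{i=1}^{n} X_{i−1}(f(i/n) − f((i−1)/n))] / (n·D). -/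
open Finset

/-- The increments of `f` along the grid `i / c`, `i = 1, …, m`, telescope. -/
theorem sum_Icc_grid_increments (f : ℝ → ℝ) (c : ℝ) (m : ℕ) :
    ∑ i ∈ Finset.Icc 1 m, (f ((i:ℝ)/c) - f (((i:ℝ) - 1)/c)) = f ((m:ℝ)/c) - f 0 := by
  induction m with
  | zero => simp
  | succ k ih =>
    rw [Finset.sum_Icc_succ_top (by omega), ih]
    push_cast
    rw [add_sub_cancel_right]
    ring

/-- Decomposition (3.4) of the paper: if the observations follow the Euler recursion
`X_i = X_{i-1} + (μ₀ + θ₀ X_{i-1})/n + σ (f(i/n) - f((i-1)/n))`, then the least squares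
estimator of `μ` decomposes as
`μ̂ = μ₀ + σ [Σ X_{i-1}² · f(1) - Σ X_{i-1} · Σ X_{i-1}(f(i/n) - f((i-1)/n))] / (n·D)`. -/
theorem lse_mu_decomposition_euler
    (n : ℕ) (hn : 2 ≤ n) (θ₀ μ₀ σ : ℝ) (f : ℝ → ℝ) (hf0 : f 0 = 0) (X : ℕ → ℝ)
    (hrec : ∀ i ∈ Finset.Icc 1 n,
      X i = X (i-1) + (μ₀ + θ₀ * X (i-1))/(n:ℝ)
            + σ * (f ((i:ℝ)/n) - f (((i:ℝ) - 1)/n)))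
    (hD : (1/(n:ℝ)) * ∑ i ∈ Finset.Icc 1 n, (X (i-1))^2
        - (1/(n:ℝ)^2) * (∑ i ∈ Finset.Icc 1 n, X (i-1))^2 ≠ 0) :
    ((∑ i ∈ Finset.Icc 1 n, (X i - X (i-1))) * (∑ i ∈ Finset.Icc 1 n, (X (i-1))^2)
      - (∑ i ∈ Finset.Icc 1 n, X (i-1))
          * (∑ i ∈ Finset.Icc 1 n, (X i - X (i-1)) * X (i-1)))
      / ((n:ℝ) * ((1/(n:ℝ)) * ∑ i ∈ Finset.Icc 1 n, (X (i-1))^2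
        - (1/(n:ℝ)^2) * (∑ i ∈ Finset.Icc 1 n, X (i-1))^2))
    = μ₀ + σ * ((∑ i ∈ Finset.Icc 1 n, (X (i-1))^2) * f 1
          - (∑ i ∈ Finset.Icc 1 n, X (i-1))
              * (∑ i ∈ Finset.Icc 1 n, X (i-1) * (f ((i:ℝ)/n) - f (((i:ℝ) - 1)/n))))
        / ((n:ℝ) * ((1/(n:ℝ)) * ∑ i ∈ Finset.Icc 1 n, (X (i-1))^2
          - (1/(n:ℝ)^2) * (∑ i ∈ Finset.Icc 1 n, X (i-1))^2)) := by
  have hn0 : (n:ℝ) ≠ 0 := by positivity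
  have hf : ∑ i ∈ Finset.Icc 1 n, (f ((i:ℝ)/n) - f (((i:ℝ) - 1)/n)) = f 1 := by
    rw [sum_Icc_grid_increments, hf0, div_self hn0, sub_zero]
  have hsum : ∑ i ∈ Finset.Icc 1 n, (X i - X (i-1))
      = μ₀ + θ₀ / n * ∑ i ∈ Finset.Icc 1 n, X (i-1) + σ * f 1 := by
    have hμ : ∑ _i ∈ Finset.Icc 1 n, μ₀ / (n:ℝ) = μ₀ := by
      rw [Finset.sum_const, Nat.card_Icc, add_tsub_cancel_right, nsmul_eq_mul,
        mul_div_cancel₀ _ hn0]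
    rw [← hf, Finset.mul_sum, Finset.mul_sum]
    nth_rewrite 1 [← hμ]
    rw [← Finset.sum_add_distrib, ← Finset.sum_add_distrib]
    refine Finset.sum_congr rfl fun i hi => ?_
    rw [hrec i hi]
    ring
  have hsum_mul : ∑ i ∈ Finset.Icc 1 n, (X i - X (i-1)) * X (i-1)
      = μ₀ / n * ∑ i ∈ Finset.Icc 1 n, X (i-1) + θ₀ / n * ∑ i ∈ Finset.Icc 1 n, (X (i-1))^2
        + σ * ∑ i ∈ Finset.Icc 1 n, X (i-1) * (f ((i:ℝ)/n) - f (((i:ℝ) - 1)/n)) := by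
    rw [Finset.mul_sum, Finset.mul_sum, Finset.mul_sum, ← Finset.sum_add_distrib,
      ← Finset.sum_add_distrib]
    refine Finset.sum_congr rfl fun i hi => ?_
    rw [hrec i hi]
    ring
  rw [hsum, hsum_mul, div_eq_iff (mul_ne_zero hn0 hD), add_mul μ₀ (_ / _),
    div_mul_cancel₀ _ (mul_ne_zero hn0 hD)]
  field_simp
  ring
end

section
/- Let n ≥ 2 be an integer, θ₀ ≠ 0, μ₀, σ ∈ ℝ, and let ε₁, ..., εₙ be real numbers. Let X₀, X₁, ..., Xₙ be real numbers satisfying the exact-solution recursion X_i = e^{θ₀/n} X_{i−1} + (μ₀/θ₀)(e^{θ₀/n} − 1) + σ ε_i for i = 1, ..., n, and suppose D := (1/n) Σ_{i=1}^{n} X_{i−1}² − (1/n²)(Σ_{i=1}^{n} X_{i−1})² ≠ 0. Then the least squares estimator μ̂ = [Σ_{i=1}^{n} (X_i − X_{i−1}) · Σ_{i=1}^{n} X_{i−1}² − Σ_{i=1}^{n} X_{i−1} · Σ_{i=1}^{n} (X_i − X_{i−1}) X_{i−1}] / (n·D) satisfies μ̂ = (μ₀/θ₀) · n(e^{θ₀/n}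 − 1) + σ · [Σ_{i=1}^{n} ε_i · Σ_{i=1}^{n} X_{i−1}² − Σ_{i=1}^{n} X_{i−1} · Σ_{i=1}^{n} X_{i−1} ε_i] / (n·D). -/
open Finset Real

/-- Decomposition (4.2) of the paper: if the observations follow the exact-solution recursion
`X_i = e^{θ₀/n} X_{i-1} + (μ₀/θ₀)(e^{θ₀/n} - 1) + σ ε_i`, then the least squares estimator
of `μ` decomposes as
`μ̂ = (μ₀/θ₀) n(e^{θ₀/n} - 1) + σ [Σ ε_i · Σ X_{i-1}² - Σ X_{i-1} · Σ X_{i-1} ε_i] / (n·D)`. -/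
theorem lse_mu_decomposition_exact
    (n : ℕ) (hn : 2 ≤ n) (θ₀ μ₀ σ : ℝ) (hθ₀ : θ₀ ≠ 0) (ε : ℕ → ℝ) (X : ℕ → ℝ)
    (hrec : ∀ i ∈ Finset.Icc 1 n,
      X i = Real.exp (θ₀/n) * X (i-1) + (μ₀/θ₀) * (Real.exp (θ₀/n) - 1) + σ * ε i)
    (hD : (1/(n:ℝ)) * ∑ i ∈ Finset.Icc 1 n, (X (i-1))^2
        - (1/(n:ℝ)^2) * (∑ i ∈ Finset.Icc 1 n, X (i-1))^2 ≠ 0) :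
    ((∑ i ∈ Finset.Icc 1 n, (X i - X (i-1))) * (∑ i ∈ Finset.Icc 1 n, (X (i-1))^2)
      - (∑ i ∈ Finset.Icc 1 n, X (i-1))
          * (∑ i ∈ Finset.Icc 1 n, (X i - X (i-1)) * X (i-1)))
      / ((n:ℝ) * ((1/(n:ℝ)) * ∑ i ∈ Finset.Icc 1 n, (X (i-1))^2
        - (1/(n:ℝ)^2) * (∑ i ∈ Finset.Icc 1 n, X (i-1))^2))
    = (μ₀/θ₀) * ((n:ℝ) * (Real.exp (θ₀/n) - 1))
      + σ * ((∑ i ∈ Finset.Icc 1 n, ε i) * (∑ i ∈ Finset.Icc 1 n, (X (i-1))^2)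
          - (∑ i ∈ Finset.Icc 1 n, X (i-1)) * (∑ i ∈ Finset.Icc 1 n, X (i-1) * ε i))
        / ((n:ℝ) * ((1/(n:ℝ)) * ∑ i ∈ Finset.Icc 1 n, (X (i-1))^2
          - (1/(n:ℝ)^2) * (∑ i ∈ Finset.Icc 1 n, X (i-1))^2)) := by
  have hn0 : (n : ℝ) ≠ 0 := by
    have : n ≠ 0 := by omega
    exact_mod_cast this
  have hsum : ∑ i ∈ Finset.Icc 1 n, (X i - X (i-1))
      = (Real.exp (θ₀/n) - 1) * ∑ i ∈ Finset.Icc 1 n, X (i-1)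
        + n * ((μ₀/θ₀) * (Real.exp (θ₀/n) - 1)) + σ * ∑ i ∈ Finset.Icc 1 n, ε i := by
    have hcard : (n : ℝ) * ((μ₀/θ₀) * (Real.exp (θ₀/n) - 1))
        = ∑ _i ∈ Finset.Icc 1 n, (μ₀/θ₀) * (Real.exp (θ₀/n) - 1) := by simp
    rw [hcard, Finset.mul_sum, Finset.mul_sum, ← Finset.sum_add_distrib,
      ← Finset.sum_add_distrib]
    refine Finset.sum_congr rfl fun i hi => ?_
    rw [hrec i hi]
    ring
  have hcross : ∑ i ∈ Finset.Icc 1 n, (X i - X (i-1)) * X (i-1)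
      = (Real.exp (θ₀/n) - 1) * ∑ i ∈ Finset.Icc 1 n, (X (i-1))^2
        + ((μ₀/θ₀) * (Real.exp (θ₀/n) - 1)) * ∑ i ∈ Finset.Icc 1 n, X (i-1)
        + σ * ∑ i ∈ Finset.Icc 1 n, X (i-1) * ε i := by
    rw [Finset.mul_sum, Finset.mul_sum, Finset.mul_sum, ← Finset.sum_add_distrib,
      ← Finset.sum_add_distrib]
    refine Finset.sum_congr rfl fun i hi => ?_
    rw [hrec i hi]
    ring
  rw [hsum, hcross, div_eq_iff (mul_ne_zero hn0 hD), add_mul ((μ₀/θ₀) * _),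
    div_mul_cancel₀ _ (mul_ne_zero hn0 hD)]
  generalize ∑ i ∈ Finset.Icc 1 n, (X (i-1))^2 = Q
  generalize ∑ i ∈ Finset.Icc 1 n, X (i-1) = S
  field_simp
  ring
end
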